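/- arXiv:2211.07239 — 2 statements merged into one kernel-verified Lean document; each statement's English description precedes it below -/
import Mathlib

section
/- Let m ≥ 1 be an integer and let ζ : ℝ^d → ℝ^d be m-times continuously differentiable with λ := inf_{θ∈[0,1]} inf_{x∈ℝ^d} |det(I + θ Dζ(x))| > 0 and M_m := max_{0≤k≤m} sup_{x∈ℝ^d} |D^k ζ(x)| < ∞. Then for each θ ∈ [0,1] the map τ_θ(x) = x + θζ(x) is a C^m-diffeomorphism of ℝ^d onto itself, and there exist constants λ' > 0, λ'' < ∞ depending only on d, λ and M_1, and a constant M'_m = M'_m(d, λ, M_m) < ∞, such that λ' ≤ |det Dτ_θ^{-1}(x)| ≤ λ'' for all x ∈ ℝ^d and θ ∈ [0,1], and max_{1≤k≤m} sup_{x∈ℝ^d} |D^k τ_θ^{-1}(x)| ≤ M'_m. -/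
open MeasureTheory Real

noncomputable section

/-- `ℝ^d` with the Euclidean norm. -/
abbrev Rd (d : ℕ) : Type := EuclideanSpace ℝ (Fin d)

section GlobalInverse

open Filter Topology Set

/-- A proper local homeomorphism from a simply connected, locally path-connected Hausdorff space to
itself is bijective. -/
theorem IsLocalHomeomorph.bijective_of_isProperMap {X : Type*} [TopologicalSpace X] [T2Space X]
    [SimplyConnectedSpace X] [LocallyPathConnectedSpace X] {f : X → X}
    (hf : IsLocalHomeomorph f) (hp : IsProperMap f) : Function.Bijective f := by
  have hcov : IsCoveringMap f := by
    rw [isCoveringMap_iff_isCoveringMapOn_univ]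
    refine hp.isClosedMap.isCoveringMapOn_of_isLocalHomeomorphOn (fun x _ => ?_)
      hf.isLocalHomeomorphOn
    refine (hp.isCompact_preimage isCompact_singleton).finite
      (.of_openPartialHomeomorph f subset_rfl fun e _ => ?_)
    obtain ⟨φ, hφ, h⟩ := hf e
    exact ⟨φ, hφ, h.symm⟩
  have key (a : X) : ∃ F : C(X, X), F (f a) = a ∧ f ∘ F = id := by
    obtain ⟨F, hF, -⟩ := hcov.existsUnique_continuousMap_lifts (ContinuousMap.id X) (f a) a rfl
    exact ⟨F, hF⟩
  refine ⟨fun a b hab => ?_, fun y => ?_⟩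
  · obtain ⟨F, hFa, hF⟩ := key a
    have h : F ∘ f = id := hcov.eq_of_comp_eq (F.continuous.comp hp.continuous) continuous_id
      (by rw [← Function.comp_assoc, hF]; rfl) a hFa
    calc a = F (f a) := hFa.symm
      _ = F (f b) := by rw [hab]
      _ = b := congrFun h b
  · obtain ⟨F, -, hF⟩ := key y
    exact ⟨F y, congrFun hF y⟩

variable {E : Type*} [NormedAddCommGroup E] [NormedSpace ℝ E]

/-- **Hadamard's global inverse function theorem**: a proper `C^n` map with everywhere invertible
derivative is a `C^n` diffeomorphism. -/
theorem ContDiff.exists_homeomorph_of_tendsto_cocompact [FiniteDimensional ℝ E]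
    {n : WithTop ℕ∞} (hn : n ≠ 0) {f : E → E}
    (hf : ContDiff ℝ n f) (hdet : ∀ x, (fderiv ℝ f x).det ≠ 0)
    (hp : Tendsto f (cocompact E) (cocompact E)) :
    ∃ h : E ≃ₜ E, ⇑h = f ∧ ContDiff ℝ n h.symm := by
  have : CompleteSpace E := FiniteDimensional.complete ℝ E
  have : ProperSpace E := FiniteDimensional.proper_real E
  have hd (x : E) : HasFDerivAt f
      ((fderiv ℝ f x).toContinuousLinearEquivOfDetNeZero (hdet x) : E →L[ℝ] E) x := by
    rw [ContinuousLinearMap.coe_toContinuousLinearEquivOfDetNeZero]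
    exact (hf.differentiable hn x).hasFDerivAt
  have hloc : IsLocalHomeomorph f := fun x =>
    ⟨hf.contDiffAt.toOpenPartialHomeomorph f (hd x) hn,
      hf.contDiffAt.mem_toOpenPartialHomeomorph_source (hd x) hn, rfl⟩
  have hbij := hloc.bijective_of_isProperMap
    (isProperMap_iff_tendsto_cocompact.2 ⟨hf.continuous, hp⟩)
  exact ⟨hloc.toHomeomorphOfBijective hbij, rfl, Homeomorph.contDiff_symm _ hd hf⟩

theorem tendsto_add_cocompact_of_norm_le [FiniteDimensional ℝ E]
    {g : E → E} {C : ℝ} (hg : ∀ x, ‖g x‖ ≤ C) :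
    Tendsto (fun x => x + g x) (cocompact E) (cocompact E) := by
  have : ProperSpace E := FiniteDimensional.proper_real E
  rw [← Metric.cobounded_eq_cocompact, ← tendsto_norm_atTop_iff_cobounded]
  refine tendsto_atTop_mono (fun x => ?_)
    (tendsto_atTop_add_const_right _ (-C) tendsto_norm_cobounded_atTop)
  have h := norm_sub_le (x + g x) (g x)
  rw [add_sub_cancel_right] at h
  linarith [hg x]

theorem isOpen_setOf_det_ne_zero : IsOpen {A : E →L[ℝ] E | A.det ≠ 0} :=
  isOpen_ne.preimage ContinuousLinearMap.continuous_det

theorem contDiffAt_inverse_of_det_ne_zero [FiniteDimensional ℝ E]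
    {n : WithTop ℕ∞} {A : E →L[ℝ] E} (hA : A.det ≠ 0) :
    ContDiffAt ℝ n ContinuousLinearMap.inverse A := by
  have : CompleteSpace E := FiniteDimensional.complete ℝ E
  simpa using contDiffAt_map_inverse (n := n) (A.toContinuousLinearEquivOfDetNeZero hA)

theorem exists_abs_det_le [FiniteDimensional ℝ E] (C : ℝ) :
    ∃ B : ℝ, 0 < B ∧ ∀ A : E →L[ℝ] E, ‖A‖ ≤ C → |A.det| ≤ B := by
  have : ProperSpace (E →L[ℝ] E) := FiniteDimensional.proper_real _
  obtain ⟨B, hB⟩ := (isCompact_closedBall (0 : E →L[ℝ] E) C).exists_bound_of_continuousOn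
    (ContinuousLinearMap.continuous_det (𝕜 := ℝ) (E := E)).continuousOn
  exact ⟨max B 1, by positivity, fun A hA => le_max_of_le_left (hB A (by simpa using hA))⟩

/-- The derivatives of operator inversion up to a given order are bounded on bounded sets on which
the determinant stays away from zero. -/
theorem exists_norm_iteratedFDeriv_inverse_le [FiniteDimensional ℝ E]
    (C : ℝ) {lam : ℝ} (hlam : 0 < lam) (n : ℕ) :
    ∃ B : ℝ, ∀ A : E →L[ℝ] E, ‖A‖ ≤ C → lam ≤ |A.det| → ∀ i ≤ n,
      ‖iteratedFDeriv ℝ i (ContinuousLinearMap.inverse : (E →L[ℝ] E) → (E →L[ℝ] E)) A‖ ≤ B := by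
  have : ProperSpace (E →L[ℝ] E) := FiniteDimensional.proper_real _
  have hK : IsCompact (Metric.closedBall (0 : E →L[ℝ] E) C ∩ {A | lam ≤ |A.det|}) :=
    (isCompact_closedBall _ _).inter_right
      (isClosed_le continuous_const ContinuousLinearMap.continuous_det.abs)
  have hb (i : ℕ) := hK.exists_bound_of_continuousOn
    (f := iteratedFDeriv ℝ i (ContinuousLinearMap.inverse : (E →L[ℝ] E) → (E →L[ℝ] E)))
    fun A hA => ((contDiffAt_inverse_of_det_ne_zero (n := i)
      (abs_pos.1 (hlam.trans_le hA.2))).continuousAt_iteratedFDeriv le_rfl).continuousWithinAt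
  choose B hB using hb
  refine ⟨∑ i ∈ Finset.range (n + 1), |B i|, fun A hA hdet i hi => ?_⟩
  calc _ ≤ B i := hB i A ⟨by simpa using hA, hdet⟩
    _ ≤ |B i| := le_abs_self _
    _ ≤ _ := Finset.single_le_sum (f := fun i => |B i|) (fun _ _ => abs_nonneg _)
      (Finset.mem_range.2 (by omega))

theorem fderiv_comp_fderiv_of_rightInverse {f g : E → E} (hf : Differentiable ℝ f)
    (hg : Differentiable ℝ g) (hfg : Function.RightInverse g f) (y : E) :
    (fderiv ℝ f (g y)).comp (fderiv ℝ g y) = ContinuousLinearMap.id ℝ E := by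
  rw [← fderiv_comp y (hf _) (hg _), hfg.comp_eq_id, fderiv_id]

theorem det_fderiv_mul_det_fderiv_of_rightInverse {f g : E → E} (hf : Differentiable ℝ f)
    (hg : Differentiable ℝ g) (hfg : Function.RightInverse g f) (y : E) :
    (fderiv ℝ f (g y)).det * (fderiv ℝ g y).det = 1 := by
  have h := congrArg ContinuousLinearMap.det (fderiv_comp_fderiv_of_rightInverse hf hg hfg y)
  simpa [ContinuousLinearMap.det] using h

theorem fderiv_eq_inverse_of_rightInverse [FiniteDimensional ℝ E]
    {f g : E → E} (hf : Differentiable ℝ f)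
    (hg : Differentiable ℝ g) (hfg : Function.RightInverse g f) :
    fderiv ℝ g = ContinuousLinearMap.inverse ∘ fderiv ℝ f ∘ g := by
  ext1 y
  have h := fderiv_comp_fderiv_of_rightInverse hf hg hfg y
  have h' : (fderiv ℝ g y : E →ₗ[ℝ] E) ∘ₗ (fderiv ℝ f (g y) : E →ₗ[ℝ] E) = LinearMap.id :=
    (LinearMap.comp_eq_id_comm ..).1 (congrArg ContinuousLinearMap.toLinearMap h)
  exact (ContinuousLinearMap.inverse_eq h
    (ContinuousLinearMap.ext fun v => LinearMap.congr_fun h' v)).symm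

/-- The derivatives up to order `k` of a right inverse of `f` are bounded in terms of bounds for
the derivatives of `f` and a lower bound for its Jacobian determinant. -/
theorem exists_norm_iteratedFDeriv_rightInverse_le [FiniteDimensional ℝ E]
    {C lam : ℝ} (hC : 0 ≤ C) (hlam : 0 < lam)
    (m k : ℕ) :
    ∃ K : ℝ, ∀ f g : E → E, ContDiff ℝ m f → ContDiff ℝ m g → Function.RightInverse g f →
      (∀ x, lam ≤ |(fderiv ℝ f x).det|) →
      (∀ i, 1 ≤ i → i ≤ m → ∀ x, ‖iteratedFDeriv ℝ i f x‖ ≤ C) →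
      ∀ i, 1 ≤ i → i ≤ k → i ≤ m → ∀ y, ‖iteratedFDeriv ℝ i g y‖ ≤ K := by
  induction k with
  | zero => exact ⟨0, fun f g _ _ _ _ _ i h1 h0 => by omega⟩
  | succ k ih =>
    obtain ⟨K, hK⟩ := ih
    obtain ⟨B, hB⟩ := exists_norm_iteratedFDeriv_inverse_le (E := E) C hlam k
    set D : ℝ := max K 1
    set D' : ℝ := max (k.factorial * C * D ^ k) 1
    refine ⟨max K (k.factorial * B * D' ^ k), fun f g hf hg hfg hdet hfC i hi1 hik him y => ?_⟩
    rcases Nat.lt_or_ge k i with hki | hki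
    swap
    · exact le_max_of_le_left (hK f g hf hg hfg hdet hfC i hi1 hki him y)
    obtain rfl : i = k + 1 := by omega
    have hm0 : (m : WithTop ℕ∞) ≠ 0 := by exact_mod_cast (by omega : m ≠ 0)
    have hkm : ((k : ℕ) : WithTop ℕ∞) + 1 ≤ m := by exact_mod_cast him
    have hdf : ContDiff ℝ k (fderiv ℝ f) := hf.fderiv_right hkm
    have hgk : ContDiff ℝ k g := hg.of_le (by exact_mod_cast (by omega : k ≤ m))
    have hD1 : 1 ≤ D := le_max_right _ _
    have hD'1 : 1 ≤ D' := le_max_right _ _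
    have hcomp (j : ℕ) (hj1 : 1 ≤ j) (hjk : j ≤ k) :
        ‖iteratedFDeriv ℝ j (fderiv ℝ f ∘ g) y‖ ≤ D' ^ j := by
      calc _ ≤ j.factorial * C * D ^ j :=
            norm_iteratedFDeriv_comp_le hdf hgk (by exact_mod_cast hjk) y
              (fun i hi => by
                rw [norm_iteratedFDeriv_fderiv]
                exact hfC (i + 1) (by omega) (by omega) _)
              (fun i hi1 hij =>
                (hK f g hf hg hfg hdet hfC i hi1 (by omega) (by omega) y).trans
                  ((le_max_left _ _).trans (le_self_pow₀ hD1 (by omega))))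
        _ ≤ k.factorial * C * D ^ k := by gcongr
        _ ≤ D' := le_max_left _ _
        _ ≤ D' ^ j := le_self_pow₀ hD'1 (by omega)
    have hdet0 (x : E) : (fderiv ℝ f x).det ≠ 0 := abs_pos.1 (hlam.trans_le (hdet x))
    rw [← norm_iteratedFDeriv_fderiv, fderiv_eq_inverse_of_rightInverse
      (hf.differentiable hm0) (hg.differentiable hm0) hfg]
    refine le_max_of_le_right <| norm_iteratedFDeriv_comp_le' (N := k)
      (t := {A : E →L[ℝ] E | A.det ≠ 0}) ?_ isOpen_setOf_det_ne_zero.uniqueDiffOn ?_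
      (hdf.comp hgk) le_rfl y (fun j hj => ?_) hcomp
    · rintro _ ⟨x, rfl⟩
      exact hdet0 _
    · exact fun A hA => (contDiffAt_inverse_of_det_ne_zero hA).contDiffWithinAt
    · rw [Function.comp_apply, iteratedFDerivWithin_of_isOpen j isOpen_setOf_det_ne_zero (hdet0 _)]
      refine hB _ ?_ (hdet _) j hj
      rw [← norm_iteratedFDeriv_one]
      exact hfC 1 le_rfl (by omega) _

theorem norm_iteratedFDeriv_succ_id_le (F : Type*) [NormedAddCommGroup F] [NormedSpace ℝ F]
    (n : ℕ) (x : F) : ‖iteratedFDeriv ℝ (n + 1) (fun y : F => y) x‖ ≤ 1 := by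
  rw [← norm_iteratedFDeriv_fderiv]
  have h : fderiv ℝ (fun y : F => y) = fun _ => ContinuousLinearMap.id ℝ F := funext fun _ =>
    fderiv_fun_id
  rw [h]
  cases n with
  | zero => simpa using ContinuousLinearMap.norm_id_le
  | succ n => simp [iteratedFDeriv_succ_const]

theorem norm_iteratedFDeriv_id_add_smul_le {F : Type*} [NormedAddCommGroup F] [NormedSpace ℝ F]
    {g : F → F} {θ M : ℝ} (hθ : θ ∈ Icc (0 : ℝ) 1) {i : ℕ} (hi : 1 ≤ i) (hg : ContDiff ℝ i g)
    {x : F} (hM : ‖iteratedFDeriv ℝ i g x‖ ≤ M) :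
    ‖iteratedFDeriv ℝ i (fun x => x + θ • g x) x‖ ≤ 1 + M := by
  obtain ⟨j, rfl⟩ := Nat.exists_eq_add_of_le' hi
  have h : (fun x => x + θ • g x) = (fun x : F => x) + θ • g := rfl
  have hgθ : ContDiff ℝ (j + 1 : ℕ) (θ • g) := hg.const_smul θ
  rw [h, iteratedFDeriv_add_apply contDiff_fun_id.contDiffAt hgθ.contDiffAt,
    iteratedFDeriv_const_smul_apply hg.contDiffAt]
  refine norm_add_le_of_le (norm_iteratedFDeriv_succ_id_le F j x) ?_
  rw [norm_smul, Real.norm_of_nonneg hθ.1]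
  exact (mul_le_of_le_one_left (norm_nonneg _) hθ.2).trans hM

end GlobalInverse

/-- if `ζ : ℝ^d → ℝ^d` is `C^m` (`m ≥ 1`) with
`λ ≤ |det(I + θDζ)|` for all `θ ∈ [0,1]` and `sup_x ‖D^kζ(x)‖ ≤ M_1` for `k ≤ 1`,
`≤ M_m` for `k ≤ m`, then each `τ_θ(x) = x + θζ(x)` is a `C^m`-diffeomorphism of
`ℝ^d`, and there are constants `λ' > 0, λ''` depending only on `d, λ, M_1`, and
`M'_m` depending only on `d, λ, M_m`, with
`λ' ≤ |det Dτ_θ^{-1}(x)| ≤ λ''` and `max_{1≤k≤m} sup_x ‖D^k τ_θ^{-1}(x)‖ ≤ M'_m`. -/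
theorem statement1 (d m : ℕ) (hm : 1 ≤ m) (lam M1 : ℝ) (hlam : 0 < lam) :
    ∃ lam' lam'' : ℝ, 0 < lam' ∧ ∀ Mm : ℝ, ∃ M' : ℝ,
      ∀ ζ : Rd d → Rd d, ContDiff ℝ (m : ℕ∞) ζ →
        (∀ θ ∈ Set.Icc (0 : ℝ) 1, ∀ x : Rd d,
          lam ≤ |(ContinuousLinearMap.id ℝ (Rd d) + θ • fderiv ℝ ζ x).det|) →
        (∀ k ≤ 1, ∀ x : Rd d, ‖iteratedFDeriv ℝ k ζ x‖ ≤ M1) →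
        (∀ k ≤ m, ∀ x : Rd d, ‖iteratedFDeriv ℝ k ζ x‖ ≤ Mm) →
        ∀ θ ∈ Set.Icc (0 : ℝ) 1,
          ∃ ι : Rd d → Rd d,
            Function.LeftInverse ι (fun x => x + θ • ζ x) ∧
            Function.RightInverse ι (fun x => x + θ • ζ x) ∧
            ContDiff ℝ (m : ℕ∞) ι ∧
            (∀ x : Rd d, lam' ≤ |(fderiv ℝ ι x).det| ∧ |(fderiv ℝ ι x).det| ≤ lam'') ∧
            (∀ k, 1 ≤ k → k ≤ m → ∀ x : Rd d, ‖iteratedFDeriv ℝ k ι x‖ ≤ M') := by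
  obtain ⟨B, hB0, hB⟩ := exists_abs_det_le (E := Rd d) (1 + M1)
  refine ⟨B⁻¹, lam⁻¹, by positivity, fun Mm => ?_⟩
  obtain ⟨M', hM'⟩ := exists_norm_iteratedFDeriv_rightInverse_le (E := Rd d) (C := 1 + |Mm|)
    (by positivity) hlam m m
  refine ⟨M', fun ζ hζ hdet h1 hm' θ hθ => ?_⟩
  have hζ' : ContDiff ℝ m ζ := hζ
  have hm0 : (m : WithTop ℕ∞) ≠ 0 := by exact_mod_cast (by omega : m ≠ 0)
  have hτ : ContDiff ℝ m (fun x => x + θ • ζ x) := contDiff_id.add (hζ'.const_smul θ)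
  have hfd (x : Rd d) : fderiv ℝ (fun x => x + θ • ζ x) x =
      ContinuousLinearMap.id ℝ (Rd d) + θ • fderiv ℝ ζ x :=
    ((hasFDerivAt_id x).add ((hζ'.differentiable hm0 x).hasFDerivAt.const_smul θ)).fderiv
  have hdet' (x : Rd d) : lam ≤ |(fderiv ℝ (fun x => x + θ • ζ x) x).det| := by
    rw [hfd]
    exact hdet θ hθ x
  have hbd (x : Rd d) : ‖θ • ζ x‖ ≤ M1 := by
    rw [norm_smul, Real.norm_of_nonneg hθ.1]
    refine (mul_le_of_le_one_left (norm_nonneg _) hθ.2).trans ?_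
    simpa using h1 0 zero_le_one x
  obtain ⟨h, hh, hsymm⟩ := hτ.exists_homeomorph_of_tendsto_cocompact hm0
    (fun x => abs_pos.1 (hlam.trans_le (hdet' x))) (tendsto_add_cocompact_of_norm_le hbd)
  have hright : Function.RightInverse h.symm (fun x => x + θ • ζ x) := hh ▸ h.right_inv
  refine ⟨h.symm, hh ▸ h.left_inv, hright, hsymm, fun x => ?_, fun k hk1 hkm x => ?_⟩
  · have hmul := det_fderiv_mul_det_fderiv_of_rightInverse (hτ.differentiable hm0)
      (hsymm.differentiable hm0) hright x
    rw [eq_inv_of_mul_eq_one_right hmul, abs_inv]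
    have hle : |(fderiv ℝ (fun x => x + θ • ζ x) (h.symm x)).det| ≤ B := by
      refine hB _ ?_
      rw [← norm_iteratedFDeriv_one]
      exact norm_iteratedFDeriv_id_add_smul_le hθ le_rfl
        (hζ'.of_le (by exact_mod_cast hm)) (h1 1 le_rfl _)
    have hge := hdet' (h.symm x)
    exact ⟨inv_anti₀ (hlam.trans_le hge) hle, inv_anti₀ hlam hge⟩
  · refine hM' _ _ hτ hsymm hright hdet' (fun i hi1 him y => ?_) k hk1 hkm hkm x
    exact norm_iteratedFDeriv_id_add_smul_le hθ hi1
      (hζ'.of_le (by exact_mod_cast him)) ((hm' i him y).trans (le_abs_self _))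

end
end

section
/- Let ζ : ℝ^d → ℝ^d be twice continuously differentiable with λ := inf_{θ∈[0,1]} inf_{x∈ℝ^d} |det(I + θ Dζ(x))| > 0 and M_2 := max_{0≤k≤2} sup_{x∈ℝ^d} |D^k ζ(x)| < ∞, and for θ ∈ [0,1] let τ_{θζ}(x) = x + θζ(x) (a C^2-diffeomorphism of ℝ^d). Then there is a constant N = N(d, λ, M_1, M_2) such that for every v ∈ C_0^∞(ℝ^d), each i = 1,…,d and every x ∈ ℝ^d: |I^{ζ*}v(x)| ≤ N · sup_{ℝ^d}(|ζ| + |Dζ|) · ∫_0^1 ( |v(τ_{θζ}^{-1}(x))| + |(Dv)(τ_{θζ}^{-1}(x))| ) dθ and |K_i^ζ v(x)| ≤ N · sup_{ℝ^d}(|ζ|^2 + |Dζ|^2) · ∫_0^1 ( |v(τ_{θζ}^{-1}(x))| + |(Dv)(τ_{θζ}^{-1}(x))| ) dθ. -/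
open MeasureTheory Real

noncomputable section

/-- Partial derivative in the `i`-th coordinate direction. -/
def pderiv' {d : ℕ} (i : Fin d) (f : Rd d → ℝ) : Rd d → ℝ :=
  fun x => fderiv ℝ f x (EuclideanSpace.single i 1)

/-- `I^{ζ*}v(x) = −∫_0^1 Σ_i D_i( v(ι_θ x) ζ^i(ι_θ x) |det Dι_θ(x)| ) dθ`,
where `ι θ` is the inverse of `τ_{θζ}(x) = x + θζ(x)`. -/
def Istar {d : ℕ} (ζ : Rd d → Rd d) (ι : ℝ → Rd d → Rd d) (v : Rd d → ℝ) (x : Rd d) : ℝ :=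
  -∫ θ in (0 : ℝ)..1, ∑ i : Fin d,
      pderiv' i (fun y : Rd d => v (ι θ y) * ζ (ι θ y) i * |(fderiv ℝ (ι θ) y).det|) x

/-- `K_i^ζ v(x) = ∫_0^1 (θ−1) Σ_j D_j( v(ι_θ x) ζ^i(ι_θ x) ζ^j(ι_θ x) |det Dι_θ(x)| ) dθ`. -/
def Kop {d : ℕ} (ζ : Rd d → Rd d) (ι : ℝ → Rd d → Rd d) (i : Fin d) (v : Rd d → ℝ)
    (x : Rd d) : ℝ :=
  ∫ θ in (0 : ℝ)..1, (θ - 1) * ∑ j : Fin d,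
      pderiv' j
        (fun y : Rd d => v (ι θ y) * ζ (ι θ y) i * ζ (ι θ y) j * |(fderiv ℝ (ι θ) y).det|) x

section FiniteDimensional

variable {E : Type*} [NormedAddCommGroup E] [NormedSpace ℝ E] [FiniteDimensional ℝ E]

/-- The determinant is a smooth function of a continuous linear endomorphism. -/
lemma contDiff_clm_det {n : WithTop ℕ∞} : ContDiff ℝ n fun A : E →L[ℝ] E => A.det := by
  have h : (fun A : E →L[ℝ] E => A.det) = fun A : E →L[ℝ] E =>
      ∑ σ : Equiv.Perm (Fin (Module.finrank ℝ E)), ((Equiv.Perm.sign σ : ℤ) : ℝ) *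
        ∏ i, (Module.finBasis ℝ E).coord (σ i) (A (Module.finBasis ℝ E i)) := by
    funext A
    rw [ContinuousLinearMap.det, ← LinearMap.det_toMatrix (Module.finBasis ℝ E),
      Matrix.det_apply']
    simp [LinearMap.toMatrix_apply]
  rw [h]
  refine ContDiff.sum fun σ _ => contDiff_const.mul (contDiff_prod fun i _ => ?_)
  exact (LinearMap.toContinuousLinearMap ((Module.finBasis ℝ E).coord (σ i))).contDiff.comp
    (contDiff_id.clm_apply contDiff_const)

/-- The derivative of the determinant is bounded on bounded sets. -/
lemma exists_norm_fderiv_det_le (R : ℝ) : ∃ K : ℝ, 0 ≤ K ∧ ∀ A : E →L[ℝ] E, ‖A‖ ≤ R →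
    ‖fderiv ℝ (fun B : E →L[ℝ] E => B.det) A‖ ≤ K := by
  obtain ⟨K, hK⟩ := (isCompact_closedBall (0 : E →L[ℝ] E) R).exists_bound_of_continuousOn
    ((contDiff_clm_det (E := E) (n := 1)).continuous_fderiv one_ne_zero).continuousOn
  exact ⟨max K 0, le_max_right _ _, fun A hA =>
    (hK A (mem_closedBall_zero_iff.2 hA)).trans (le_max_left _ _)⟩

/-- Right inverses of endomorphisms with bounded norm and determinant bounded away from zero are
uniformly bounded. -/
lemma exists_norm_right_inverse_le (R : ℝ) {lam : ℝ} (hlam : 0 < lam) :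
    ∃ K : ℝ, 0 ≤ K ∧ ∀ A B : E →L[ℝ] E, ‖A‖ ≤ R → lam ≤ |A.det| → A * B = 1 → ‖B‖ ≤ K := by
  have isUnit_of {A : E →L[ℝ] E} (hA : lam ≤ |A.det|) : IsUnit A := by
    have h0 : A.det ≠ 0 := abs_pos.1 (hlam.trans_le hA)
    rw [← A.coe_toContinuousLinearEquivOfDetNeZero h0]
    exact (ContinuousLinearEquiv.unitsEquiv ℝ E).symm
      (A.toContinuousLinearEquivOfDetNeZero h0) |>.isUnit
  have hc : IsCompact (Metric.closedBall (0 : E →L[ℝ] E) R ∩ {A | lam ≤ |A.det|}) :=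
    (isCompact_closedBall _ _).inter_right
      (isClosed_le continuous_const (ContinuousLinearMap.continuous_det (E := E)).abs)
  have hcont : ContinuousOn Ring.inverse
      (Metric.closedBall (0 : E →L[ℝ] E) R ∩ {A | lam ≤ |A.det|}) := by
    rintro A ⟨-, hA⟩
    obtain ⟨u, rfl⟩ := isUnit_of hA
    exact (NormedRing.inverse_continuousAt u).continuousWithinAt
  obtain ⟨K, hK⟩ := hc.exists_bound_of_continuousOn hcont
  refine ⟨max K 0, le_max_right _ _, fun A B hA hdet hAB => ?_⟩
  have hB : Ring.inverse A = B := by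
    rw [← Ring.inverse_mul_cancel_left A B (isUnit_of hdet), hAB, mul_one]
  rw [← hB]
  exact (hK A ⟨mem_closedBall_zero_iff.2 hA, hdet⟩).trans (le_max_left _ _)

/-- The inverse of a `C¹` bijection with non-vanishing Jacobian is `C¹`. -/
lemma contDiff_inverse_of_det_ne_zero {f g : E → E} (hf : ContDiff ℝ 1 f)
    (hdet : ∀ x, (fderiv ℝ f x).det ≠ 0) (hl : Function.LeftInverse g f)
    (hr : Function.RightInverse g f) : ContDiff ℝ 1 g := by
  let f' : E → E ≃L[ℝ] E := fun x => (fderiv ℝ f x).toContinuousLinearEquivOfDetNeZero (hdet x)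
  have hf' (x : E) : HasStrictFDerivAt f (f' x : E →L[ℝ] E) x := by
    rw [ContinuousLinearMap.coe_toContinuousLinearEquivOfDetNeZero]
    exact hf.contDiffAt.hasStrictFDerivAt one_ne_zero
  let e : E ≃ₜ E := (Equiv.mk f g hl hr).toHomeomorphOfContinuousOpen hf.continuous
    (isOpenMap_of_hasStrictFDerivAt_equiv hf')
  exact e.contDiff_symm (fun x => (hf' x).hasFDerivAt) hf

/-- Gradient bound for the product of a pulled back function, a pulled back weight and the Jacobian
of the inverse map. -/
lemma norm_fderiv_mul_jacobian_le {f g : E → E} {v p : E → ℝ} {lam K₁ K₂ C : ℝ} (hlam : 0 < lam)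
    (hK₁ : 0 ≤ K₁) (hf : ContDiff ℝ 2 f) (hdet : ∀ z, lam ≤ |(fderiv ℝ f z).det|)
    (hl : Function.LeftInverse g f) (hr : Function.RightInverse g f)
    (hinv : ∀ z, ∀ B : E →L[ℝ] E, fderiv ℝ f z * B = 1 → ‖B‖ ≤ K₁)
    (hJ : ∀ z, ‖fderiv ℝ (fun y => (fderiv ℝ f y).det) z‖ ≤ K₂)
    (hv : Differentiable ℝ v) (hp : Differentiable ℝ p) (hpC : ∀ z, |p z| ≤ C)
    (hpC' : ∀ z, ‖fderiv ℝ p z‖ ≤ C) (x : E) :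
    ‖fderiv ℝ (fun y => v (g y) * p (g y) * |(fderiv ℝ g y).det|) x‖ ≤
      K₁ * (1 / lam + K₂ / lam ^ 2) * C * (|v (g x)| + ‖fderiv ℝ v (g x)‖) := by
  set J : E → ℝ := fun y => (fderiv ℝ f y).det with hJdef
  have hJ0 (z : E) : 0 < |J z| := hlam.trans_le (hdet z)
  have hf1 : ContDiff ℝ 1 f := hf.of_le one_le_two
  have hg : Differentiable ℝ g :=
    (contDiff_inverse_of_det_ne_zero hf1 (fun z => abs_pos.1 (hJ0 z)) hl hr).differentiable
      one_ne_zero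
  have hJd : Differentiable ℝ J :=
    (contDiff_clm_det.comp (hf.fderiv_right (m := 1) (by norm_num))).differentiable one_ne_zero
  have hfg (y : E) : fderiv ℝ f (g y) * fderiv ℝ g y = 1 := by
    have h := ((hf1.differentiable one_ne_zero (g y)).hasFDerivAt.comp y (hg y).hasFDerivAt)
    have hid : f ∘ g = id := funext hr
    rw [hid] at h
    exact h.unique (hasFDerivAt_id y)
  have hfun : (fun y => v (g y) * p (g y) * |(fderiv ℝ g y).det|) =
      (fun z => v z * p z * |J z|⁻¹) ∘ g := by
    funext y
    have h1 : J (g y) * (fderiv ℝ g y).det = 1 := by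
      have h := congrArg (fun A : E →L[ℝ] E => LinearMap.det (A : E →ₗ[ℝ] E)) (hfg y)
      simpa [ContinuousLinearMap.toLinearMap_mul] using h
    simp only [Function.comp_apply]
    rw [eq_comm, ← abs_inv, eq_inv_of_mul_eq_one_right h1]
  have hq : HasFDerivAt (fun z => |J z|⁻¹)
      (-(|J (g x)| ^ 2)⁻¹ • ((SignType.sign (J (g x)) : ℝ) • fderiv ℝ J (g x))) (g x) :=
    (hasDerivAt_inv (hJ0 (g x)).ne').comp_hasFDerivAt (g x)
      ((hJd (g x)).hasFDerivAt.abs (abs_pos.1 (hJ0 (g x))))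
  have hh := ((hv (g x)).hasFDerivAt.mul (hp (g x)).hasFDerivAt).mul hq
  have hD := hh.comp x (hg x).hasFDerivAt
  rw [hfun, show fderiv ℝ ((fun z => v z * p z * |J z|⁻¹) ∘ g) x = _ from hD.fderiv]
  have hC : 0 ≤ C := (abs_nonneg _).trans (hpC (g x))
  have hK₂ : 0 ≤ K₂ := (norm_nonneg _).trans (hJ (g x))
  have hinvJ : |J (g x)|⁻¹ ≤ 1 / lam := by
    rw [one_div]
    exact inv_anti₀ hlam (hdet _)
  have hsign : ‖(SignType.sign (J (g x)) : ℝ)‖ = 1 := by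
    rcases lt_or_gt_of_ne (abs_pos.1 (hJ0 (g x))) with h | h <;> simp [h]
  have hqn : ‖-(|J (g x)| ^ 2)⁻¹ • ((SignType.sign (J (g x)) : ℝ) • fderiv ℝ J (g x))‖ ≤
      K₂ / lam ^ 2 := by
    rw [norm_smul, norm_smul, hsign, one_mul, norm_neg, norm_inv, norm_pow, norm_abs_eq_norm,
      Real.norm_eq_abs, div_eq_inv_mul]
    have := hdet (g x)
    gcongr
    exact hJ _
  have hvpn : ‖v (g x) • fderiv ℝ p (g x) + p (g x) • fderiv ℝ v (g x)‖ ≤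
      C * (|v (g x)| + ‖fderiv ℝ v (g x)‖) := by
    refine (norm_add_le _ _).trans ?_
    rw [norm_smul, norm_smul, Real.norm_eq_abs, Real.norm_eq_abs, mul_add, mul_comm |v (g x)|]
    gcongr
    exacts [hpC' _, hpC _]
  have hvp : ‖v (g x) * p (g x)‖ ≤ C * (|v (g x)| + ‖fderiv ℝ v (g x)‖) := by
    rw [norm_mul, Real.norm_eq_abs, Real.norm_eq_abs, mul_comm]
    gcongr
    · exact hpC _
    · exact le_add_of_nonneg_right (norm_nonneg _)
  refine (ContinuousLinearMap.opNorm_comp_le _ _).trans ?_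
  have hmain := norm_add_le
    ((v (g x) * p (g x)) • (-(|J (g x)| ^ 2)⁻¹ • ((SignType.sign (J (g x)) : ℝ) •
      fderiv ℝ J (g x))))
    (|J (g x)|⁻¹ • (v (g x) • fderiv ℝ p (g x) + p (g x) • fderiv ℝ v (g x)))
  rw [norm_smul (v (g x) * p (g x)), norm_smul (|J (g x)|⁻¹), norm_inv, norm_abs_eq_norm,
    Real.norm_eq_abs (J (g x))] at hmain
  refine (mul_le_mul (hmain.trans (add_le_add
    (mul_le_mul hvp hqn (norm_nonneg _) (by positivity))
    (mul_le_mul hinvJ hvpn (norm_nonneg _) (by positivity))))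
    (hinv (g x) _ (hfg x)) (norm_nonneg _) (by positivity)).trans (le_of_eq ?_)
  ring

end FiniteDimensional

/-- The inverses of `x ↦ x + θ • ζ x` depend continuously on the parameter `θ`. -/
lemma continuousOn_inverse_parameter {E : Type*} [NormedAddCommGroup E] [NormedSpace ℝ E]
    {ζ : E → E} {ι : ℝ → E → E} {s : Set ℝ} {M : ℝ}
    (hζ : ∀ x, ‖ζ x‖ ≤ M) (hι : ∀ θ ∈ s, Continuous (ι θ))
    (hl : ∀ θ ∈ s, Function.LeftInverse (ι θ) (fun x => x + θ • ζ x))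
    (hr : ∀ θ ∈ s, Function.RightInverse (ι θ) (fun x => x + θ • ζ x)) (x : E) :
    ContinuousOn (fun θ => ι θ x) s := by
  intro θ hθ
  have heq : ∀ t ∈ s, ι t x = ι θ (x + (θ - t) • ζ (ι t x)) := by
    intro t ht
    have h1 : ι t x + t • ζ (ι t x) = x := hr t ht x
    have h2 : x + (θ - t) • ζ (ι t x) = ι t x + θ • ζ (ι t x) := by
      nth_rewrite 1 [← h1]
      module
    rw [h2]
    exact (hl θ hθ _).symm
  refine ContinuousWithinAt.congr (f := fun t => ι θ (x + (θ - t) • ζ (ι t x))) ?_ heq (heq θ hθ)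
  refine (hι θ hθ).continuousAt.comp_continuousWithinAt (continuousWithinAt_const.add ?_)
  have hz : Filter.Tendsto (fun t => |θ - t| * M) (nhdsWithin θ s) (nhds 0) := by
    have h : Continuous fun t : ℝ => |θ - t| * M := by fun_prop
    simpa using (h.tendsto θ).mono_left nhdsWithin_le_nhds
  rw [ContinuousWithinAt, sub_self, zero_smul]
  refine squeeze_zero_norm (fun t => ?_) hz
  rw [norm_smul, Real.norm_eq_abs]
  exact mul_le_mul_of_nonneg_left (hζ _) (abs_nonneg _)


lemma abs_partialDeriv_le {d : ℕ} (i : Fin d) (f : Rd d → ℝ) (x : Rd d) :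
    |pderiv' i f x| ≤ ‖fderiv ℝ f x‖ := by
  simpa [pderiv'] using (fderiv ℝ f x).le_opNorm (EuclideanSpace.single i 1)

lemma abs_coord_le {d : ℕ} (y : Rd d) (i : Fin d) : |y i| ≤ ‖y‖ :=
  PiLp.norm_apply_le y i

lemma hasFDerivAt_coord {d : ℕ} {ζ : Rd d → Rd d} {z : Rd d} (hζ : DifferentiableAt ℝ ζ z)
    (i : Fin d) :
    HasFDerivAt (fun y => ζ y i) ((EuclideanSpace.proj i).comp (fderiv ℝ ζ z)) z :=
  (EuclideanSpace.proj (𝕜 := ℝ) i).hasFDerivAt.comp z hζ.hasFDerivAt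

lemma norm_proj_comp_le {d : ℕ} (A : Rd d →L[ℝ] Rd d) (i : Fin d) :
    ‖(EuclideanSpace.proj (𝕜 := ℝ) i : Rd d →L[ℝ] ℝ).comp A‖ ≤ ‖A‖ :=
  ContinuousLinearMap.opNorm_le_bound _ (norm_nonneg _) fun y =>
    (abs_coord_le (A y) i).trans (A.le_opNorm y)

/-- Gradient bound for a weighted pullback under the inverse of `x ↦ x + θ • ζ x`, with a constant
depending only on the dimension and on the bounds for `ζ`. -/
lemma exists_norm_fderiv_pullback_le (d : ℕ) (M₁ M₂ : ℝ) {lam : ℝ} (hlam : 0 < lam) :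
    ∃ N : ℝ, 0 ≤ N ∧ ∀ (ζ : Rd d → Rd d) (g : Rd d → Rd d) (θ : ℝ), ContDiff ℝ 2 ζ →
      θ ∈ Set.Icc (0 : ℝ) 1 →
      (∀ x, lam ≤ |(ContinuousLinearMap.id ℝ (Rd d) + θ • fderiv ℝ ζ x).det|) →
      (∀ x, ‖fderiv ℝ ζ x‖ ≤ M₁) → (∀ x, ‖fderiv ℝ (fderiv ℝ ζ) x‖ ≤ M₂) →
      Function.LeftInverse g (fun x => x + θ • ζ x) →
      Function.RightInverse g (fun x => x + θ • ζ x) →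
      Continuous g ∧ ∀ (v p : Rd d → ℝ) (C : ℝ), Differentiable ℝ v → Differentiable ℝ p →
        (∀ z, |p z| ≤ C) → (∀ z, ‖fderiv ℝ p z‖ ≤ C) → ∀ x,
        ‖fderiv ℝ (fun y => v (g y) * p (g y) * |(fderiv ℝ g y).det|) x‖ ≤
          N * C * (|v (g x)| + ‖fderiv ℝ v (g x)‖) := by
  obtain ⟨K₁, hK₁, hinv⟩ := exists_norm_right_inverse_le (E := Rd d) (1 + M₁) hlam
  obtain ⟨K, hK, hdetb⟩ := exists_norm_fderiv_det_le (E := Rd d) (1 + M₁)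
  refine ⟨K₁ * (1 / lam + K * max M₂ 0 / lam ^ 2), by positivity, ?_⟩
  intro ζ g θ hζ hθ hdet hM₁ hM₂ hl hr
  have hf : ContDiff ℝ 2 (fun x => x + θ • ζ x) := contDiff_id.add (hζ.const_smul θ)
  have hζd : Differentiable ℝ ζ := hζ.differentiable two_ne_zero
  have hfd (z : Rd d) : fderiv ℝ (fun x => x + θ • ζ x) z =
      ContinuousLinearMap.id ℝ (Rd d) + θ • fderiv ℝ ζ z :=
    ((hasFDerivAt_id z).add ((hζd z).hasFDerivAt.const_smul θ)).fderiv
  have hθ1 : ‖θ‖ ≤ 1 := by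
    rw [Real.norm_eq_abs, abs_of_nonneg hθ.1]
    exact hθ.2
  have hA (z : Rd d) : ‖ContinuousLinearMap.id ℝ (Rd d) + θ • fderiv ℝ ζ z‖ ≤ 1 + M₁ := by
    refine (norm_add_le _ _).trans (add_le_add ContinuousLinearMap.norm_id_le ?_)
    rw [norm_smul]
    exact (mul_le_of_le_one_left (norm_nonneg _) hθ1).trans (hM₁ z)
  refine ⟨(contDiff_inverse_of_det_ne_zero (hf.of_le one_le_two) (fun z => ?_) hl hr).continuous,
    fun v p C hv hp hpC hpC' x => ?_⟩
  · rw [hfd]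
    exact abs_pos.1 (hlam.trans_le (hdet z))
  refine norm_fderiv_mul_jacobian_le hlam hK₁ hf (fun z => ?_) hl hr (fun z B hB => ?_)
    (fun z => ?_) hv hp hpC hpC' x
  · rw [hfd]
    exact hdet z
  · rw [hfd] at hB
    exact hinv _ B (hA z) (hdet z) hB
  · simp only [hfd]
    have hζ' : HasFDerivAt (fun y => ContinuousLinearMap.id ℝ (Rd d) + θ • fderiv ℝ ζ y)
        (θ • fderiv ℝ (fderiv ℝ ζ) z) z :=
      (((hζ.fderiv_right (m := 1) (by norm_num)).differentiable one_ne_zero z).hasFDerivAt.const_smul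
        θ).const_add _
    have hD := ((contDiff_clm_det (E := Rd d) (n := 1)).differentiable one_ne_zero
      (ContinuousLinearMap.id ℝ (Rd d) + θ • fderiv ℝ ζ z)).hasFDerivAt.comp z hζ'
    rw [show fderiv ℝ (fun y => (ContinuousLinearMap.id ℝ (Rd d) + θ • fderiv ℝ ζ y).det) z = _
      from hD.fderiv]
    refine (ContinuousLinearMap.opNorm_comp_le _ _).trans
      (mul_le_mul (hdetb _ (hA z)) ?_ (norm_nonneg _) hK)
    rw [norm_smul]
    exact (mul_le_of_le_one_left (norm_nonneg _) hθ1).trans ((hM₂ z).trans (le_max_left _ _))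


/-- with `ζ : ℝ^d → ℝ^d` of class `C²`, `λ ≤ |det(I + θDζ)|`,
`sup‖D^kζ‖ ≤ M₁ (k ≤ 1)`, `≤ M₂ (k ≤ 2)`, and `ι θ` the inverse of
`τ_{θζ}(x) = x + θζ(x)`, there is `N = N(d, λ, M₁, M₂)` such that for every
`v ∈ C_0^∞`, each `i` and every `x`:
`|I^{ζ*}v(x)| ≤ N sup(|ζ|+|Dζ|) ∫_0^1 (|v(ι_θ x)| + |(Dv)(ι_θ x)|) dθ` and
`|K_i^ζ v(x)| ≤ N sup(|ζ|²+|Dζ|²) ∫_0^1 (|v(ι_θ x)| + |(Dv)(ι_θ x)|) dθ`. -/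
theorem statement6 (d : ℕ) (lam M1 M2 : ℝ) (hlam : 0 < lam) :
    ∃ N : ℝ,
      ∀ ζ : Rd d → Rd d, ContDiff ℝ 2 ζ →
        (∀ θ ∈ Set.Icc (0 : ℝ) 1, ∀ x : Rd d,
          lam ≤ |(ContinuousLinearMap.id ℝ (Rd d) + θ • fderiv ℝ ζ x).det|) →
        (∀ k ≤ 1, ∀ x : Rd d, ‖iteratedFDeriv ℝ k ζ x‖ ≤ M1) →
        (∀ k ≤ 2, ∀ x : Rd d, ‖iteratedFDeriv ℝ k ζ x‖ ≤ M2) →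
        ∀ ι : ℝ → Rd d → Rd d,
          (∀ θ ∈ Set.Icc (0 : ℝ) 1,
            Function.LeftInverse (ι θ) (fun x => x + θ • ζ x) ∧
            Function.RightInverse (ι θ) (fun x => x + θ • ζ x)) →
          ∀ v : Rd d → ℝ, ContDiff ℝ (⊤ : ℕ∞) v → HasCompactSupport v →
            ∀ x : Rd d,
              (∀ C : ℝ, (∀ y : Rd d, ‖ζ y‖ + ‖fderiv ℝ ζ y‖ ≤ C) →
                |Istar ζ ι v x|
                  ≤ N * C * ∫ θ in (0 : ℝ)..1, (|v (ι θ x)| + ‖fderiv ℝ v (ι θ x)‖)) ∧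
              (∀ i : Fin d, ∀ C : ℝ, (∀ y : Rd d, ‖ζ y‖ ^ 2 + ‖fderiv ℝ ζ y‖ ^ 2 ≤ C) →
                |Kop ζ ι i v x|
                  ≤ N * C * ∫ θ in (0 : ℝ)..1, (|v (ι θ x)| + ‖fderiv ℝ v (ι θ x)‖)) := by
  obtain ⟨N, hN, hbound⟩ := exists_norm_fderiv_pullback_le d M1 M2 hlam
  refine ⟨d * N, fun ζ hζ hdet hM1 hM2 ι hι v hv _ x => ?_⟩
  have hζd : Differentiable ℝ ζ := hζ.differentiable two_ne_zero
  have hζ0 (y : Rd d) : ‖ζ y‖ ≤ M1 := by simpa using hM1 0 zero_le_one y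
  have hζ1 (y : Rd d) : ‖fderiv ℝ ζ y‖ ≤ M1 := by
    simpa [norm_iteratedFDeriv_one] using hM1 1 le_rfl y
  have hζ2 (y : Rd d) : ‖fderiv ℝ (fderiv ℝ ζ) y‖ ≤ M2 := by
    rw [← norm_iteratedFDeriv_one, norm_iteratedFDeriv_fderiv]
    exact hM2 2 le_rfl y
  have hb (θ : ℝ) (hθ : θ ∈ Set.Icc (0 : ℝ) 1) :=
    hbound ζ (ι θ) θ hζ hθ (hdet θ hθ) hζ1 hζ2 (hι θ hθ).1 (hι θ hθ).2
  have hvd : Differentiable ℝ v := hv.differentiable (by simp)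
  have hιc : ContinuousOn (fun θ => ι θ x) (Set.Icc 0 1) :=
    continuousOn_inverse_parameter hζ0 (fun θ hθ => (hb θ hθ).1) (fun θ hθ => (hι θ hθ).1)
      (fun θ hθ => (hι θ hθ).2) x
  have hint : IntervalIntegrable (fun θ => |v (ι θ x)| + ‖fderiv ℝ v (ι θ x)‖) volume 0 1 := by
    refine ContinuousOn.intervalIntegrable ?_
    rw [Set.uIcc_of_le zero_le_one]
    exact (hv.continuous.comp_continuousOn hιc).abs.add
      ((hv.continuous_fderiv (by simp)).comp_continuousOn hιc).norm
  have integral_le (F : ℝ → ℝ) (C : ℝ)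
      (hF : ∀ θ ∈ Set.Icc (0 : ℝ) 1,
        |F θ| ≤ d * N * C * (|v (ι θ x)| + ‖fderiv ℝ v (ι θ x)‖)) :
      |∫ θ in (0 : ℝ)..1, F θ| ≤
        d * N * C * ∫ θ in (0 : ℝ)..1, (|v (ι θ x)| + ‖fderiv ℝ v (ι θ x)‖) := by
    rw [← intervalIntegral.integral_const_mul]
    exact intervalIntegral.norm_integral_le_of_norm_le (f := F) zero_le_one
      (Filter.Eventually.of_forall fun θ hθ => hF θ (Set.Ioc_subset_Icc_self hθ))
      (hint.const_mul (d * N * C))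
  have sum_le (θ : ℝ) (hθ : θ ∈ Set.Icc (0 : ℝ) 1) (C : ℝ) (p : Fin d → Rd d → ℝ)
      (hp : ∀ j, Differentiable ℝ (p j)) (hpC : ∀ j z, |p j z| ≤ C)
      (hpC' : ∀ j z, ‖fderiv ℝ (p j) z‖ ≤ C) :
      |∑ j, pderiv' j (fun y => v (ι θ y) * p j (ι θ y) * |(fderiv ℝ (ι θ) y).det|) x| ≤
        d * N * C * (|v (ι θ x)| + ‖fderiv ℝ v (ι θ x)‖) := by
    refine (Finset.abs_sum_le_sum_abs _ _).trans ((Finset.sum_le_card_nsmul _ _ _ fun j _ =>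
      (abs_partialDeriv_le _ _ _).trans
        ((hb θ hθ).2 v (p j) C hvd (hp j) (hpC j) (hpC' j) x)).trans (le_of_eq ?_))
    rw [Finset.card_univ, Fintype.card_fin, nsmul_eq_mul]
    ring
  refine ⟨fun C hC => ?_, fun i C hC => ?_⟩
  · rw [Istar, abs_neg]
    refine integral_le _ C fun θ hθ => sum_le θ hθ C (fun i z => ζ z i)
      (fun i z => (hasFDerivAt_coord (hζd z) i).differentiableAt) (fun i z => ?_) fun i z => ?_
    · exact (abs_coord_le _ i).trans ((le_add_of_nonneg_right (norm_nonneg _)).trans (hC z))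
    · rw [(hasFDerivAt_coord (hζd z) i).fderiv]
      exact (norm_proj_comp_le _ i).trans ((le_add_of_nonneg_left (norm_nonneg _)).trans (hC z))
  · refine integral_le _ C fun θ hθ => ?_
    have hθ1 : |θ - 1| ≤ 1 := abs_le.2 ⟨by linarith [hθ.1], by linarith [hθ.2]⟩
    have hp (j : Fin d) (z : Rd d) :=
      (hasFDerivAt_coord (hζd z) i).mul (hasFDerivAt_coord (hζd z) j)
    rw [abs_mul]
    refine (mul_le_of_le_one_left (abs_nonneg _) hθ1).trans ?_
    simp only [mul_assoc (v _) (ζ _ i)]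
    refine sum_le θ hθ C (fun j z => ζ z i * ζ z j) (fun j z => (hp j z).differentiableAt)
      (fun j z => ?_) fun j z => ?_
    · rw [abs_mul]
      refine (mul_le_mul (abs_coord_le _ i) (abs_coord_le _ j) (abs_nonneg _)
        (norm_nonneg _)).trans ?_
      nlinarith [hC z, sq_nonneg ‖fderiv ℝ ζ z‖]
    · rw [show fderiv ℝ (fun z => ζ z i * ζ z j) z = _ from (hp j z).fderiv]
      refine (norm_add_le _ _).trans ?_
      rw [norm_smul, norm_smul]
      refine (add_le_add
        (mul_le_mul (abs_coord_le _ i) (norm_proj_comp_le _ j) (norm_nonneg _) (norm_nonneg _))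
        (mul_le_mul (abs_coord_le _ j) (norm_proj_comp_le _ i) (norm_nonneg _)
          (norm_nonneg _))).trans ?_
      nlinarith [hC z, sq_nonneg (‖ζ z‖ - ‖fderiv ℝ ζ z‖)]

end
end
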